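/- Suppose P and P' are Kantor pairs over 𝕂, L is a 5-graded Lie algebra that tightly envelops P, and χ = (χ⁻, χ⁺) : P → P' is a surjective homomorphism of Kantor pairs. Then there exists a unique homomorphism of 5-graded Lie algebras φ : L → 𝔎(P') extending χ̃ := χ⁻ ⊕ χ⁺ : T_L(P) → T_{𝔎(P')}(P'). Moreover φ is surjective, and ker(φ) = {d ∈ [T_L(P), T_L(P)] : [d, T_L(P)] ⊆ ker(χ̃)} + ker(χ̃). -/

import Mathlib

/-- A Kantor pair over `K`: a pair of modules `(Pm, Pp)` (for `P⁻`, `P⁺`) with trilinear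
products `tm : P⁻ × P⁺ × P⁻ → P⁻` and `tp : P⁺ × P⁻ × P⁺ → P⁺` satisfying the Kantor
identities (K1) and (K2). -/
structure KantorPair (K : Type*) [CommRing K] (Pm Pp : Type*)
    [AddCommGroup Pm] [AddCommGroup Pp] [Module K Pm] [Module K Pp] where
  tm : Pm → Pp → Pm → Pm
  tp : Pp → Pm → Pp → Pp
  tm_add₁ : ∀ x x' y z, tm (x + x') y z = tm x y z + tm x' y z
  tm_smul₁ : ∀ (a : K) x y z, tm (a • x) y z = a • tm x y z
  tm_add₂ : ∀ x y y' z, tm x (y + y') z = tm x y z + tm x y' z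
  tm_smul₂ : ∀ (a : K) x y z, tm x (a • y) z = a • tm x y z
  tm_add₃ : ∀ x y z z', tm x y (z + z') = tm x y z + tm x y z'
  tm_smul₃ : ∀ (a : K) x y z, tm x y (a • z) = a • tm x y z
  tp_add₁ : ∀ x x' y z, tp (x + x') y z = tp x y z + tp x' y z
  tp_smul₁ : ∀ (a : K) x y z, tp (a • x) y z = a • tp x y z
  tp_add₂ : ∀ x y y' z, tp x (y + y') z = tp x y z + tp x y' z
  tp_smul₂ : ∀ (a : K) x y z, tp x (a • y) z = a • tp x y z
  tp_add₃ : ∀ x y z z', tp x y (z + z') = tp x y z + tp x y z'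
  tp_smul₃ : ∀ (a : K) x y z, tp x y (a • z) = a • tp x y z
  k1m : ∀ (x z u : Pm) (y w : Pp),
    tm x y (tm z w u) - tm z w (tm x y u) = tm (tm x y z) w u - tm z (tp y x w) u
  k1p : ∀ (x z u : Pp) (y w : Pm),
    tp x y (tp z w u) - tp z w (tp x y u) = tp (tp x y z) w u - tp z (tm y x w) u
  k2m : ∀ (x z u : Pm) (w v : Pp),
    (tm x (tp w u v) z - tm z (tp w u v) x) + tm u w (tm x v z - tm z v x)
      = tm (tm x w z - tm z w x) v u - tm u v (tm x w z - tm z w x)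
  k2p : ∀ (x z u : Pp) (w v : Pm),
    (tp x (tm w u v) z - tp z (tm w u v) x) + tp u w (tp x v z - tp z v x)
      = tp (tp x w z - tp z w x) v u - tp u v (tp x w z - tp z w x)

namespace KantorPair

variable {K : Type*} [CommRing K] {Pm Pp : Type*}
  [AddCommGroup Pm] [AddCommGroup Pp] [Module K Pm] [Module K Pp]

/-- `Q = (Qm, Qp)` is an ideal of the Kantor pair:
`{P,P,Q} + {P,Q,P} + {Q,P,P} ⊆ Q` on each side. -/
def IsIdealPair (KP : KantorPair K Pm Pp) (Qm : Submodule K Pm) (Qp : Submodule K Pp) : Prop :=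
  (∀ (x z : Pm) (y : Pp) (q : Pm), q ∈ Qm → KP.tm x y q ∈ Qm ∧ KP.tm q y z ∈ Qm) ∧
  (∀ (x z : Pm) (r : Pp), r ∈ Qp → KP.tm x r z ∈ Qm) ∧
  (∀ (x z : Pp) (y : Pm) (q : Pp), q ∈ Qp → KP.tp x y q ∈ Qp ∧ KP.tp q y z ∈ Qp) ∧
  (∀ (x z : Pp) (r : Pm), r ∈ Qm → KP.tp x r z ∈ Qp)

/-- A Kantor pair is simple if some product is nonzero and its only ideals are `0` and `P`. -/
def IsSimplePair (KP : KantorPair K Pm Pp) : Prop :=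
  ((∃ x y z, KP.tm x y z ≠ 0) ∨ (∃ x y z, KP.tp x y z ≠ 0)) ∧
  ∀ Qm Qp, KP.IsIdealPair Qm Qp → (Qm = ⊥ ∧ Qp = ⊥) ∨ (Qm = ⊤ ∧ Qp = ⊤)

/-- `(ωm, ωp)` belongs to the centroid of the Kantor pair. -/
def InCentroid (KP : KantorPair K Pm Pp) (ωm : Pm →ₗ[K] Pm) (ωp : Pp →ₗ[K] Pp) : Prop :=
  (∀ x y z, ωm (KP.tm x y z) = KP.tm (ωm x) y z ∧
      ωm (KP.tm x y z) = KP.tm x (ωp y) z ∧ ωm (KP.tm x y z) = KP.tm x y (ωm z)) ∧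
  (∀ x y z, ωp (KP.tp x y z) = KP.tp (ωp x) y z ∧
      ωp (KP.tp x y z) = KP.tp x (ωm y) z ∧ ωp (KP.tp x y z) = KP.tp x y (ωp z))

/-- The Kantor pair is central: `a ↦ (a • id, a • id)` is an isomorphism of `K`
onto the centroid. -/
def IsCentralPair (KP : KantorPair K Pm Pp) : Prop :=
  (∀ ωm ωp, KP.InCentroid ωm ωp →
    ∃ a : K, ωm = a • (LinearMap.id : Pm →ₗ[K] Pm) ∧ ωp = a • (LinearMap.id : Pp →ₗ[K] Pp)) ∧
  ∀ a : K, a • (LinearMap.id : Pm →ₗ[K] Pm) = 0 →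
    a • (LinearMap.id : Pp →ₗ[K] Pp) = 0 → a = 0

/-- A Jordan pair is a Kantor pair with vanishing K-operators, i.e. symmetric products. -/
def IsJordanPair (KP : KantorPair K Pm Pp) : Prop :=
  (∀ (x z : Pm) (y : Pp), KP.tm x y z = KP.tm z y x) ∧
  (∀ (x z : Pp) (y : Pm), KP.tp x y z = KP.tp z y x)

end KantorPair

/-- A 5-grading (= BC₁-grading) of a Lie algebra `L` over `K`:
an internal direct sum decomposition `L = ⊕_{i ∈ ℤ} L_i` with `⁅L_i, L_j⁆ ⊆ L_{i+j}`
and `L_i = 0` for `|i| > 2`. -/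
structure FiveGrading (K : Type*) [CommRing K] (L : Type*) [LieRing L] [LieAlgebra K L] where
  g : ℤ → Submodule K L
  internal : DirectSum.IsInternal g
  lie_mem : ∀ (i j : ℤ) (x y : L), x ∈ g i → y ∈ g j → ⁅x, y⁆ ∈ g (i + j)
  vanish : ∀ i : ℤ, 2 < |i| → g i = ⊥

/-- `T_L(P) = L_{-1} ⊕ L_1` as a submodule of `L`. -/
def Tsub {K : Type*} [CommRing K] {L : Type*} [LieRing L] [LieAlgebra K L]
    (fg : FiveGrading K L) : Submodule K L :=
  fg.g (-1) ⊔ fg.g 1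

/-- The span of all brackets `⁅x, y⁆` with `x ∈ U`, `y ∈ V`. -/
def brkSpan (K : Type*) [CommRing K] {L : Type*} [LieRing L] [LieAlgebra K L]
    (U V : Submodule K L) : Submodule K L :=
  Submodule.span K {w : L | ∃ x ∈ U, ∃ y ∈ V, w = ⁅x, y⁆}

/-- A 5-graded Lie algebra `L` tightly envelops the Kantor pair `(L_{-1}, L_1)` if it
is generated as a Lie algebra by `T = L_{-1} ⊕ L_1` and `Z(L) ∩ [T, T] = 0`. -/
def Tight (K : Type*) [CommRing K] {L : Type*} [LieRing L] [LieAlgebra K L]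
    (fg : FiveGrading K L) : Prop :=
  LieSubalgebra.lieSpan K L ↑(Tsub fg) = ⊤ ∧
  ∀ z ∈ brkSpan K (Tsub fg) (Tsub fg), (∀ u : L, ⁅z, u⁆ = 0) → z = 0

/-- A 5-graded Lie algebra `(L, fg)` envelops a Kantor pair `KP`: there are identifications
of `P⁻` with `L_{-1}` and `P⁺` with `L_1` under which the products of `KP` are the products
`⁅⁅x, y⁆, z⁆` of `L`. -/
structure Envelops {K : Type*} [CommRing K] {Pm Pp : Type*}
    [AddCommGroup Pm] [AddCommGroup Pp] [Module K Pm] [Module K Pp]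
    (KP : KantorPair K Pm Pp)
    {L : Type*} [LieRing L] [LieAlgebra K L] (fg : FiveGrading K L) where
  em : Pm →ₗ[K] L
  ep : Pp →ₗ[K] L
  inj_m : Function.Injective em
  inj_p : Function.Injective ep
  range_m : LinearMap.range em = fg.g (-1)
  range_p : LinearMap.range ep = fg.g 1
  compat_m : ∀ (x z : Pm) (y : Pp), em (KP.tm x y z) = ⁅⁅em x, ep y⁆, em z⁆
  compat_p : ∀ (x z : Pp) (y : Pm), ep (KP.tp x y z) = ⁅⁅ep x, em y⁆, ep z⁆

/-- A short Peirce grading (SP-grading) of a Kantor pair: a `ℤ`-grading with support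
contained in `{0, 1}`. -/
structure SPGrading {K : Type*} [CommRing K] {Pm Pp : Type*}
    [AddCommGroup Pm] [AddCommGroup Pp] [Module K Pm] [Module K Pp]
    (KP : KantorPair K Pm Pp) where
  Qm : ℤ → Submodule K Pm
  Qp : ℤ → Submodule K Pp
  sup_m : Qm 0 ⊔ Qm 1 = ⊤
  disj_m : Disjoint (Qm 0) (Qm 1)
  sup_p : Qp 0 ⊔ Qp 1 = ⊤
  disj_p : Disjoint (Qp 0) (Qp 1)
  vanish_m : ∀ i : ℤ, i ≠ 0 → i ≠ 1 → Qm i = ⊥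
  vanish_p : ∀ i : ℤ, i ≠ 0 → i ≠ 1 → Qp i = ⊥
  grade_m : ∀ (i j k : ℤ) (x : Pm) (y : Pp) (z : Pm),
    x ∈ Qm i → y ∈ Qp j → z ∈ Qm k → KP.tm x y z ∈ Qm (i - j + k)
  grade_p : ∀ (i j k : ℤ) (x : Pp) (y : Pm) (z : Pp),
    x ∈ Qp i → y ∈ Qm j → z ∈ Qp k → KP.tp x y z ∈ Qp (i - j + k)

/-- `KPc` is the reflection `P̌` of the SP-graded Kantor pair `(KP, SP)`:
`P̌^σ = P₀^{-σ} ⊕ P₁^σ`, with products given by the reflection formula. -/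
def IsReflection {K : Type*} [CommRing K] {Pm Pp : Type*}
    [AddCommGroup Pm] [AddCommGroup Pp] [Module K Pm] [Module K Pp]
    (KP : KantorPair K Pm Pp) (SP : SPGrading KP)
    (KPc : KantorPair K ((SP.Qp 0) × (SP.Qm 1)) ((SP.Qm 0) × (SP.Qp 1))) : Prop :=
  (∀ (a c : (SP.Qm 0) × (SP.Qp 1)) (b : (SP.Qp 0) × (SP.Qm 1)),
    ((KPc.tp a b c).1 : Pm)
      = KP.tm a.1 b.1 c.1 - KP.tm b.2 a.2 c.1 + (KP.tm a.1 c.2 b.2 - KP.tm b.2 c.2 a.1) ∧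
    ((KPc.tp a b c).2 : Pp)
      = KP.tp a.2 b.2 c.2 - KP.tp b.1 a.1 c.2 + (KP.tp a.2 c.1 b.1 - KP.tp b.1 c.1 a.2)) ∧
  (∀ (a c : (SP.Qp 0) × (SP.Qm 1)) (b : (SP.Qm 0) × (SP.Qp 1)),
    ((KPc.tm a b c).1 : Pp)
      = KP.tp a.1 b.1 c.1 - KP.tp b.2 a.2 c.1 + (KP.tp a.1 c.2 b.2 - KP.tp b.2 c.2 a.1) ∧
    ((KPc.tm a b c).2 : Pm)
      = KP.tm a.2 b.2 c.2 - KP.tm b.1 a.1 c.2 + (KP.tm a.2 c.1 b.1 - KP.tm b.1 c.1 a.2))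

section Helpers

variable {K : Type*} [CommRing K]

theorem brk_mem {L : Type*} [LieRing L] [LieAlgebra K L] {U V : Submodule K L} {x y : L}
    (hx : x ∈ U) (hy : y ∈ V) : ⁅x, y⁆ ∈ brkSpan K U V :=
  Submodule.subset_span ⟨x, hx, y, hy, rfl⟩

theorem brk_le {L : Type*} [LieRing L] [LieAlgebra K L] {U V W : Submodule K L}
    (h : ∀ x ∈ U, ∀ y ∈ V, ⁅x, y⁆ ∈ W) : brkSpan K U V ≤ W := by
  refine Submodule.span_le.2 ?_
  rintro _ ⟨x, hx, y, hy, rfl⟩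
  exact h x hx y hy

theorem brk_triple {L : Type*} [LieRing L] [LieAlgebra K L] {V : Submodule K L}
    (h : ∀ x ∈ V, ∀ y ∈ V, ∀ z ∈ V, ⁅⁅x, y⁆, z⁆ ∈ V) {d z : L} (hd : d ∈ brkSpan K V V)
    (hz : z ∈ V) : ⁅d, z⁆ ∈ V := by
  induction hd using Submodule.span_induction with
  | mem w hw =>
    obtain ⟨x, hx, y, hy, rfl⟩ := hw
    exact h x hx y hy z hz
  | zero => simp
  | add a b _ _ ha hb => rw [add_lie]; exact V.add_mem ha hb
  | smul c a _ ha => rw [smul_lie]; exact V.smul_mem c ha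

theorem brk_four {L : Type*} [LieRing L] [LieAlgebra K L] {V : Submodule K L}
    (h : ∀ x ∈ V, ∀ y ∈ V, ∀ z ∈ V, ⁅⁅x, y⁆, z⁆ ∈ V) {d e : L} (hd : d ∈ brkSpan K V V)
    (he : e ∈ brkSpan K V V) : ⁅d, e⁆ ∈ brkSpan K V V := by
  induction he using Submodule.span_induction with
  | mem w hw =>
    obtain ⟨x, hx, y, hy, rfl⟩ := hw
    rw [leibniz_lie]
    exact add_mem (brk_mem (brk_triple h hd hx) hy) (brk_mem hx (brk_triple h hd hy))
  | zero => simp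
  | add a b _ _ ha hb => rw [lie_add]; exact add_mem ha hb
  | smul c a _ ha => rw [lie_smul]; exact Submodule.smul_mem _ c ha

/-- `V + [V,V]` as a Lie subalgebra when `[[V,V],V] ⊆ V`. -/
def tripleAlg {L : Type*} [LieRing L] [LieAlgebra K L] (V : Submodule K L)
    (h : ∀ x ∈ V, ∀ y ∈ V, ∀ z ∈ V, ⁅⁅x, y⁆, z⁆ ∈ V) : LieSubalgebra K L :=
  { V ⊔ brkSpan K V V with
    lie_mem' := by
      intro a b ha hb
      obtain ⟨x, hx, d, hd, rfl⟩ := Submodule.mem_sup.1 ha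
      obtain ⟨y, hy, e, he, rfl⟩ := Submodule.mem_sup.1 hb
      have h1 : ⁅x, e⁆ ∈ V := by
        rw [← lie_skew]; exact V.neg_mem (brk_triple h he hx)
      have h2 := brk_triple h hd hy
      have h3 := brk_four h hd he
      have h4 : ⁅x, y⁆ ∈ brkSpan K V V := brk_mem hx hy
      change _ ∈ V ⊔ brkSpan K V V
      have e : ⁅x + d, y + e⁆ = (⁅x, e⁆ + ⁅d, y⁆) + (⁅x, y⁆ + ⁅d, e⁆) := by
        simp only [lie_add, add_lie]; abel
      rw [e]
      exact Submodule.add_mem_sup (add_mem h1 h2) (add_mem h4 h3) }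

theorem mem_tripleAlg {L : Type*} [LieRing L] [LieAlgebra K L] {V : Submodule K L}
    {h : ∀ x ∈ V, ∀ y ∈ V, ∀ z ∈ V, ⁅⁅x, y⁆, z⁆ ∈ V} {x : L} :
    x ∈ tripleAlg V h ↔ x ∈ V ⊔ brkSpan K V V := Iff.rfl

section Env

variable {Pm Pp : Type*} [AddCommGroup Pm] [AddCommGroup Pp] [Module K Pm] [Module K Pp]
  {KP : KantorPair K Pm Pp} {L : Type*} [LieRing L] [LieAlgebra K L] {fg : FiveGrading K L}

theorem Envelops.mem_m (E : Envelops KP fg) (a : Pm) : E.em a ∈ fg.g (-1) :=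
  E.range_m ▸ LinearMap.mem_range_self E.em a

theorem Envelops.mem_p (E : Envelops KP fg) (b : Pp) : E.ep b ∈ fg.g 1 :=
  E.range_p ▸ LinearMap.mem_range_self E.ep b

theorem Envelops.mem_T (E : Envelops KP fg) (a : Pm) (b : Pp) : E.em a + E.ep b ∈ Tsub fg :=
  Submodule.add_mem_sup (E.mem_m a) (E.mem_p b)

theorem Envelops.exists_of_mem_T (E : Envelops KP fg) {t : L} (ht : t ∈ Tsub fg) :
    ∃ a b, t = E.em a + E.ep b := by
  obtain ⟨x, hx, y, hy, rfl⟩ := Submodule.mem_sup.1 ht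
  rw [← E.range_m] at hx
  rw [← E.range_p] at hy
  obtain ⟨a, rfl⟩ := hx
  obtain ⟨b, rfl⟩ := hy
  exact ⟨a, b, rfl⟩

theorem Envelops.mmm (E : Envelops KP fg) (x y z : Pm) : ⁅⁅E.em x, E.em y⁆, E.em z⁆ = 0 := by
  have := fg.lie_mem _ _ _ _ (fg.lie_mem _ _ _ _ (E.mem_m x) (E.mem_m y)) (E.mem_m z)
  rw [fg.vanish _ (by norm_num)] at this
  simpa using this

theorem Envelops.ppp (E : Envelops KP fg) (x y z : Pp) : ⁅⁅E.ep x, E.ep y⁆, E.ep z⁆ = 0 := by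
  have := fg.lie_mem _ _ _ _ (fg.lie_mem _ _ _ _ (E.mem_p x) (E.mem_p y)) (E.mem_p z)
  rw [fg.vanish _ (by norm_num)] at this
  simpa using this

theorem Envelops.triple (E : Envelops KP fg) (a₁ a₂ a₃ : Pm) (b₁ b₂ b₃ : Pp) :
    ⁅⁅E.em a₁ + E.ep b₁, E.em a₂ + E.ep b₂⁆, E.em a₃ + E.ep b₃⁆ =
      E.em (KP.tm a₁ b₂ a₃ - KP.tm a₂ b₁ a₃ + (KP.tm a₁ b₃ a₂ - KP.tm a₂ b₃ a₁)) +
      E.ep (KP.tp b₁ a₂ b₃ - KP.tp b₂ a₁ b₃ + (KP.tp b₁ a₃ b₂ - KP.tp b₂ a₃ b₁)) := by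
  have h1 : ∀ x y z : L, ⁅⁅x, y⁆, z⁆ = ⁅⁅x, z⁆, y⁆ - ⁅⁅y, z⁆, x⁆ := by
    intro x y z
    rw [lie_lie, ← lie_skew x ⁅y, z⁆, ← lie_skew y ⁅x, z⁆]; abel
  have h2 : ∀ x y z : L, ⁅⁅x, y⁆, z⁆ = - ⁅⁅y, x⁆, z⁆ := by
    intro x y z
    rw [← lie_skew x y, neg_lie]
  simp only [add_lie, lie_add, map_add, map_sub, E.compat_m, E.compat_p, E.mmm, E.ppp]
  rw [h1 (E.em a₁) (E.em a₂) (E.ep b₃), h1 (E.ep b₁) (E.ep b₂) (E.em a₃),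
    h2 (E.ep b₁) (E.em a₂) (E.em a₃), h2 (E.em a₁) (E.ep b₂) (E.ep b₃)]
  abel

theorem Envelops.T_triple (E : Envelops KP fg) :
    ∀ x ∈ Tsub fg, ∀ y ∈ Tsub fg, ∀ z ∈ Tsub fg, ⁅⁅x, y⁆, z⁆ ∈ Tsub fg := by
  intro x hx y hy z hz
  obtain ⟨a₁, b₁, rfl⟩ := E.exists_of_mem_T hx
  obtain ⟨a₂, b₂, rfl⟩ := E.exists_of_mem_T hy
  obtain ⟨a₃, b₃, rfl⟩ := E.exists_of_mem_T hz
  rw [E.triple]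
  exact E.mem_T _ _

theorem Envelops.sup_eq_top (E : Envelops KP fg) (ht : Tight K fg) :
    Tsub fg ⊔ brkSpan K (Tsub fg) (Tsub fg) = ⊤ := by
  rw [eq_top_iff]
  intro x _
  have h : LieSubalgebra.lieSpan K L ↑(Tsub fg) ≤ tripleAlg (Tsub fg) E.T_triple :=
    LieSubalgebra.lieSpan_le.2 fun y hy => mem_tripleAlg.2 (Submodule.mem_sup_left hy)
  rw [ht.1] at h
  exact mem_tripleAlg.1 (h (LieSubalgebra.mem_top x))

theorem FiveGrading.brk_le_even (fg : FiveGrading K L) :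
    brkSpan K (Tsub fg) (Tsub fg) ≤ ⨆ i ∈ ({-2, 0, 2} : Set ℤ), fg.g i := by
  refine brk_le ?_
  intro x hx y hy
  obtain ⟨a, ha, b, hb, rfl⟩ := Submodule.mem_sup.1 hx
  obtain ⟨c, hc, d, hd, rfl⟩ := Submodule.mem_sup.1 hy
  have key : ∀ i ∈ ({-2, 0, 2} : Set ℤ), fg.g i ≤ ⨆ i ∈ ({-2, 0, 2} : Set ℤ), fg.g i :=
    fun i hi => le_biSup fg.g hi
  simp only [add_lie, lie_add]
  exact add_mem (add_mem (key _ (by norm_num) (fg.lie_mem _ _ _ _ ha hc))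
      (key _ (by norm_num) (fg.lie_mem _ _ _ _ hb hc)))
    (add_mem (key _ (by norm_num) (fg.lie_mem _ _ _ _ ha hd))
      (key _ (by norm_num) (fg.lie_mem _ _ _ _ hb hd)))

theorem FiveGrading.disj (fg : FiveGrading K L) :
    Disjoint (Tsub fg) (brkSpan K (Tsub fg) (Tsub fg)) := by
  have hd : Disjoint (⨆ i ∈ ({-1, 1} : Set ℤ), fg.g i) (⨆ i ∈ ({-2, 0, 2} : Set ℤ), fg.g i) :=
    fg.internal.submodule_iSupIndep.disjoint_biSup_biSup (by
      rw [Set.disjoint_left]; rintro i (rfl | rfl) h <;> norm_num at h)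
  refine hd.mono ?_ fg.brk_le_even
  exact sup_le (le_biSup fg.g (by simp)) (le_biSup fg.g (by simp))

theorem FiveGrading.eq_zero (fg : FiveGrading K L) {t d : L} (ht : t ∈ Tsub fg)
    (hd : d ∈ brkSpan K (Tsub fg) (Tsub fg)) (h : t + d = 0) : t = 0 ∧ d = 0 := by
  have h1 : t = -d := eq_neg_of_add_eq_zero_left h
  have h2 : t = 0 := Submodule.disjoint_def.1 fg.disj t ht (h1 ▸ neg_mem hd)
  exact ⟨h2, by simpa [h2] using h⟩

theorem Envelops.eq_zero (E : Envelops KP fg) {a : Pm} {b : Pp} (h : E.em a + E.ep b = 0) :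
    a = 0 ∧ b = 0 := by
  have hd : Disjoint (fg.g (-1)) (fg.g 1) :=
    fg.internal.submodule_iSupIndep.pairwiseDisjoint (by norm_num)
  have h1 : E.em a = -E.ep b := eq_neg_of_add_eq_zero_left h
  have h2 : E.em a = 0 := Submodule.disjoint_def.1 hd _ (E.mem_m a) (h1 ▸ neg_mem (E.mem_p b))
  refine ⟨E.inj_m (by simpa using h2), E.inj_p ?_⟩
  simpa [h2] using h

theorem Tight.zero_of_comm (ht : Tight K fg) {d : L} (hd : d ∈ brkSpan K (Tsub fg) (Tsub fg))
    (h : ∀ t ∈ Tsub fg, ⁅d, t⁆ = 0) : d = 0 := by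
  refine ht.2 d hd fun u => ?_
  have hu : u ∈ LieSubalgebra.lieSpan K L (Tsub fg : Set L) := by rw [ht.1]; trivial
  induction hu using LieSubalgebra.lieSpan_induction with
  | mem x hx => exact h x hx
  | zero => simp
  | smul c x _ hx => simp [hx]
  | add x y _ _ hx hy => simp [hx, hy]
  | lie x y _ _ hx hy => rw [leibniz_lie, hx, hy]; simp

end Env

end Helpers

/-- Suppose `L` tightly envelops the Kantor pair `P` and
`χ = (χ⁻, χ⁺) : P → P'` is a surjective homomorphism of Kantor pairs.  Then there is a
unique homomorphism of 5-graded Lie algebras `φ : L → 𝔎(P')` extending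
`χ̃ = χ⁻ ⊕ χ⁺ : T_L(P) → T_{𝔎(P')}(P')`; `φ` is surjective and
`ker φ = {d ∈ [T,T] : ⁅d, T⁆ ⊆ ker χ̃} + ker χ̃`.  (`𝔎(P')` is represented by an arbitrary
5-graded Lie algebra `L'` tightly enveloping `P'`.) -/
theorem statement5 {K : Type*} [CommRing K] (h6 : IsUnit (6 : K))
    {Pm Pp Pm' Pp' : Type*}
    [AddCommGroup Pm] [AddCommGroup Pp] [Module K Pm] [Module K Pp]
    [AddCommGroup Pm'] [AddCommGroup Pp'] [Module K Pm'] [Module K Pp']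
    (KP : KantorPair K Pm Pp) (KP' : KantorPair K Pm' Pp')
    {L L' : Type*} [LieRing L] [LieAlgebra K L] [LieRing L'] [LieAlgebra K L']
    (fg : FiveGrading K L) (fg' : FiveGrading K L')
    (E : Envelops KP fg) (E' : Envelops KP' fg')
    (ht : Tight K fg) (ht' : Tight K fg')
    (χm : Pm →ₗ[K] Pm') (χp : Pp →ₗ[K] Pp')
    (hχm : ∀ (x z : Pm) (y : Pp), χm (KP.tm x y z) = KP'.tm (χm x) (χp y) (χm z))
    (hχp : ∀ (x z : Pp) (y : Pm), χp (KP.tp x y z) = KP'.tp (χp x) (χm y) (χp z))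
    (hsm : Function.Surjective χm) (hsp : Function.Surjective χp) :
    (∃! φ : L →ₗ⁅K⁆ L',
      (∀ (i : ℤ) (x : L), x ∈ fg.g i → φ x ∈ fg'.g i) ∧
      (∀ x : Pm, φ (E.em x) = E'.em (χm x)) ∧ (∀ y : Pp, φ (E.ep y) = E'.ep (χp y))) ∧
    (∀ φ : L →ₗ⁅K⁆ L',
      ((∀ (i : ℤ) (x : L), x ∈ fg.g i → φ x ∈ fg'.g i) ∧
       (∀ x : Pm, φ (E.em x) = E'.em (χm x)) ∧ (∀ y : Pp, φ (E.ep y) = E'.ep (χp y))) →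
      Function.Surjective φ ∧
      ∀ zz : L, φ zz = 0 ↔
        ∃ d ∈ brkSpan K (Tsub fg) (Tsub fg),
          (∀ t ∈ Tsub fg, ⁅d, t⁆ ∈
            ((LinearMap.ker χm).map E.em ⊔ (LinearMap.ker χp).map E.ep : Submodule K L)) ∧
          ∃ k ∈ ((LinearMap.ker χm).map E.em ⊔ (LinearMap.ker χp).map E.ep : Submodule K L),
            zz = d + k) := by
  classical
  have hT : ∀ φ : L →ₗ⁅K⁆ L', (∀ x : Pm, φ (E.em x) = E'.em (χm x)) →
      (∀ y : Pp, φ (E.ep y) = E'.ep (χp y)) → ∀ t ∈ Tsub fg, φ t ∈ Tsub fg' := by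
    intro φ h1 h2 t ht
    obtain ⟨a, b, rfl⟩ := E.exists_of_mem_T ht
    rw [map_add, h1, h2]
    exact E'.mem_T _ _
  have hTT : ∀ φ : L →ₗ⁅K⁆ L', (∀ t ∈ Tsub fg, φ t ∈ Tsub fg') →
      ∀ d ∈ brkSpan K (Tsub fg) (Tsub fg), φ d ∈ brkSpan K (Tsub fg') (Tsub fg') := by
    intro φ h
    have : brkSpan K (Tsub fg) (Tsub fg) ≤
        (brkSpan K (Tsub fg') (Tsub fg')).comap (φ : L →ₗ[K] L') := by
      refine brk_le fun x hx y hy => ?_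
      change φ ⁅x, y⁆ ∈ brkSpan K (Tsub fg') (Tsub fg')
      rw [LieHom.map_lie]
      exact brk_mem (h x hx) (h y hy)
    exact this
  have hsurj : ∀ φ : L →ₗ⁅K⁆ L', (∀ x : Pm, φ (E.em x) = E'.em (χm x)) →
      (∀ y : Pp, φ (E.ep y) = E'.ep (χp y)) →
      ∀ t ∈ Tsub fg', ∃ s ∈ Tsub fg, φ s = t := by
    intro φ h1 h2 t ht
    obtain ⟨a, b, rfl⟩ := E'.exists_of_mem_T ht
    obtain ⟨a, rfl⟩ := hsm a
    obtain ⟨b, rfl⟩ := hsp b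
    exact ⟨_, E.mem_T a b, by rw [map_add, h1, h2]⟩
  refine ⟨?_, ?_⟩
  · -- existence via the graph
    let Γmap : (Pm × Pp) →ₗ[K] L × L' :=
      (E.em.coprod E.ep).prod ((E'.em ∘ₗ χm).coprod (E'.ep ∘ₗ χp))
    let Γ : Submodule K (L × L') := LinearMap.range Γmap
    have hΓ : ∀ a b, (E.em a + E.ep b, E'.em (χm a) + E'.ep (χp b)) ∈ Γ :=
      fun a b => ⟨(a, b), rfl⟩
    have hΓ' : ∀ x ∈ Γ, ∃ a b, x = (E.em a + E.ep b, E'.em (χm a) + E'.ep (χp b)) := by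
      rintro _ ⟨⟨a, b⟩, rfl⟩
      exact ⟨a, b, rfl⟩
    have htr : ∀ x ∈ Γ, ∀ y ∈ Γ, ∀ z ∈ Γ, ⁅⁅x, y⁆, z⁆ ∈ Γ := by
      intro x hx y hy z hz
      obtain ⟨a₁, b₁, rfl⟩ := hΓ' x hx
      obtain ⟨a₂, b₂, rfl⟩ := hΓ' y hy
      obtain ⟨a₃, b₃, rfl⟩ := hΓ' z hz
      simp only [LieAlgebra.Prod.bracket_apply, E.triple, E'.triple]
      simp only [← hχm, ← hχp, ← map_sub, ← map_add]
      exact hΓ _ _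
    let G := tripleAlg Γ htr
    let p1 : G →ₗ⁅K⁆ L := (LieHom.fst K L L').comp G.incl
    let p2 : G →ₗ⁅K⁆ L' := (LieHom.snd K L L').comp G.incl
    have hbr : ∀ x ∈ brkSpan K Γ Γ, x.1 ∈ brkSpan K (Tsub fg) (Tsub fg) ∧
        x.2 ∈ brkSpan K (Tsub fg') (Tsub fg') := by
      have : brkSpan K Γ Γ ≤ (brkSpan K (Tsub fg) (Tsub fg)).prod
          (brkSpan K (Tsub fg') (Tsub fg')) := by
        refine brk_le fun x hx y hy => ?_
        obtain ⟨a₁, b₁, rfl⟩ := hΓ' x hx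
        obtain ⟨a₂, b₂, rfl⟩ := hΓ' y hy
        exact ⟨brk_mem (E.mem_T _ _) (E.mem_T _ _), brk_mem (E'.mem_T _ _) (E'.mem_T _ _)⟩
      exact fun x hx => this hx
    have hzero : ∀ x ∈ Γ, x.1 = 0 → x.2 = 0 := by
      intro x hx h0
      obtain ⟨a, b, rfl⟩ := hΓ' x hx
      obtain ⟨rfl, rfl⟩ := E.eq_zero h0
      simp
    have hinj : Function.Injective p1 := by
      rw [injective_iff_map_eq_zero]
      rintro ⟨x, hx⟩ h0
      obtain ⟨t, htm, d, hd, rfl⟩ := Submodule.mem_sup.1 (mem_tripleAlg.1 hx)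
      have h0 : t.1 + d.1 = 0 := h0
      have ht1 : t.1 ∈ Tsub fg := by
        obtain ⟨a, b, rfl⟩ := hΓ' t htm
        exact E.mem_T _ _
      obtain ⟨h1, h2⟩ := fg.eq_zero ht1 (hbr d hd).1 h0
      have h3 := hzero t htm h1
      have h4 : d.2 = 0 := by
        refine ht'.zero_of_comm (hbr d hd).2 fun s hs => ?_
        obtain ⟨a, b, rfl⟩ := E'.exists_of_mem_T hs
        obtain ⟨a, rfl⟩ := hsm a
        obtain ⟨b, rfl⟩ := hsp b
        refine hzero _ (brk_triple htr hd (hΓ a b)) ?_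
        simp [h2]
      apply Subtype.ext
      exact Prod.ext h0 (by simp [h3, h4])
    have hsu : Function.Surjective p1 := by
      have h : LieSubalgebra.lieSpan K L ↑(Tsub fg) ≤ p1.range := by
        refine LieSubalgebra.lieSpan_le.2 fun y hy => ?_
        obtain ⟨a, b, rfl⟩ := E.exists_of_mem_T hy
        exact ⟨⟨_, mem_tripleAlg.2 (Submodule.mem_sup_left (hΓ a b))⟩, rfl⟩
      rw [ht.1] at h
      intro x
      exact h (LieSubalgebra.mem_top x)
    let e : G ≃ₗ⁅K⁆ L := LieEquiv.ofBijective p1 ⟨hinj, hsu⟩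
    let φ : L →ₗ⁅K⁆ L' := p2.comp e.symm.toLieHom
    have hφ : ∀ x : L × L', x ∈ Γ → φ x.1 = x.2 := by
      intro x hx
      have hxG : x ∈ G := mem_tripleAlg.2 (Submodule.mem_sup_left hx)
      have : e.symm x.1 = ⟨x, hxG⟩ := e.symm_apply_apply ⟨x, hxG⟩
      change p2 (e.symm x.1) = x.2
      rw [this]
      rfl
    have hφm : ∀ x : Pm, φ (E.em x) = E'.em (χm x) := by
      intro x
      simpa using hφ _ (hΓ x 0)
    have hφp : ∀ y : Pp, φ (E.ep y) = E'.ep (χp y) := by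
      intro y
      simpa using hφ _ (hΓ 0 y)
    refine ⟨φ, ⟨?_, hφm, hφp⟩, ?_⟩
    · let q : ℤ → Submodule K L := fun i => fg.g i ⊓ (fg'.g i).comap (φ : L →ₗ[K] L')
      have hqm : fg.g (-1) ≤ q (-1) := by
        intro x hx
        refine ⟨hx, ?_⟩
        rw [← E.range_m] at hx
        obtain ⟨a, rfl⟩ := hx
        change φ (E.em a) ∈ fg'.g (-1)
        rw [hφm]
        exact E'.mem_m _
      have hqp : fg.g 1 ≤ q 1 := by
        intro x hx
        refine ⟨hx, ?_⟩
        rw [← E.range_p] at hx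
        obtain ⟨a, rfl⟩ := hx
        change φ (E.ep a) ∈ fg'.g 1
        rw [hφp]
        exact E'.mem_p _
      have hql : ∀ i j x y, x ∈ q i → y ∈ q j → ⁅x, y⁆ ∈ ⨆ i, q i := by
        intro i j x y hx hy
        refine Submodule.mem_iSup_of_mem (i + j) ⟨fg.lie_mem _ _ _ _ hx.1 hy.1, ?_⟩
        change φ ⁅x, y⁆ ∈ fg'.g (i + j)
        rw [LieHom.map_lie]
        exact fg'.lie_mem _ _ _ _ hx.2 hy.2
      have htop : ⨆ i, q i = ⊤ := by
        rw [eq_top_iff, ← E.sup_eq_top ht]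
        refine sup_le (sup_le (hqm.trans (le_iSup q _)) (hqp.trans (le_iSup q _))) ?_
        refine brk_le ?_
        intro x hx y hy
        obtain ⟨a, ha, b, hb, rfl⟩ := Submodule.mem_sup.1 hx
        obtain ⟨c, hc, d, hd, rfl⟩ := Submodule.mem_sup.1 hy
        simp only [add_lie, lie_add]
        exact add_mem (add_mem (hql _ _ _ _ (hqm ha) (hqm hc)) (hql _ _ _ _ (hqp hb) (hqm hc)))
          (add_mem (hql _ _ _ _ (hqm ha) (hqp hd)) (hql _ _ _ _ (hqp hb) (hqp hd)))
      intro i x hx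
      have hle : (⊤ : Submodule K L) ≤ q i ⊔ ⨆ (j) (_ : j ≠ i), fg.g j := by
        rw [← htop]
        refine iSup_le fun j => ?_
        by_cases hj : j = i
        · subst hj; exact le_sup_left
        · exact le_sup_of_le_right (inf_le_left.trans (le_iSup₂_of_le j hj le_rfl))
      obtain ⟨u, hu, v, hv, huv⟩ := Submodule.mem_sup.1 (hle (Submodule.mem_top (x := x)))
      have hv' : v ∈ fg.g i := by
        have : v = x - u := by rw [← huv]; abel
        rw [this]; exact sub_mem hx hu.1
      have hv0 : v = 0 :=
        Submodule.disjoint_def.1 (fg.internal.submodule_iSupIndep i) v hv' hv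
      have : u = x := by rw [← huv, hv0, add_zero]
      exact this ▸ hu.2
    · rintro ψ ⟨-, hm, hp⟩
      ext x
      have hx : x ∈ LieSubalgebra.lieSpan K L (Tsub fg : Set L) := by rw [ht.1]; trivial
      induction hx using LieSubalgebra.lieSpan_induction with
      | mem x hx =>
        obtain ⟨a, b, rfl⟩ := E.exists_of_mem_T hx
        rw [map_add, map_add, hm, hp, hφm, hφp]
      | zero => simp
      | smul c x _ hx => simp [hx]
      | add x y _ _ hx hy => simp [hx, hy]
      | lie x y _ _ hx hy => rw [LieHom.map_lie, LieHom.map_lie, hx, hy]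
  · rintro φ ⟨-, hm, hp⟩
    have hT1 := hT φ hm hp
    have hT2 := hTT φ hT1
    have hS := hsurj φ hm hp
    have hker : ∀ t ∈ Tsub fg, φ t = 0 → t ∈
        ((LinearMap.ker χm).map E.em ⊔ (LinearMap.ker χp).map E.ep : Submodule K L) := by
      intro t htm h0
      obtain ⟨a, b, rfl⟩ := E.exists_of_mem_T htm
      rw [map_add, hm, hp] at h0
      obtain ⟨h1, h2⟩ := E'.eq_zero h0
      exact Submodule.add_mem_sup ⟨a, h1, rfl⟩ ⟨b, h2, rfl⟩
    have hker' : ∀ t ∈ ((LinearMap.ker χm).map E.em ⊔ (LinearMap.ker χp).map E.ep :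
        Submodule K L), φ t = 0 := by
      intro t htm
      obtain ⟨_, ⟨a, ha, rfl⟩, _, ⟨b, hb, rfl⟩, rfl⟩ := Submodule.mem_sup.1 htm
      have ha : χm a = 0 := ha
      have hb : χp b = 0 := hb
      rw [map_add, hm, hp, ha, hb]
      simp
    refine ⟨?_, fun zz => ⟨fun h0 => ?_, ?_⟩⟩
    · have h : LieSubalgebra.lieSpan K L' ↑(Tsub fg') ≤ φ.range := by
        refine LieSubalgebra.lieSpan_le.2 fun y hy => ?_
        obtain ⟨s, -, hs⟩ := hS y hy
        exact ⟨s, hs⟩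
      rw [ht'.1] at h
      intro x
      exact h (LieSubalgebra.mem_top x)
    · have hz : zz ∈ Tsub fg ⊔ brkSpan K (Tsub fg) (Tsub fg) := by
        rw [E.sup_eq_top ht]; trivial
      obtain ⟨t, htm, d, hd, rfl⟩ := Submodule.mem_sup.1 hz
      rw [map_add] at h0
      obtain ⟨h1, h2⟩ := fg'.eq_zero (hT1 t htm) (hT2 d hd) h0
      refine ⟨d, hd, fun s hs => ?_, t, hker t htm h1, add_comm _ _⟩
      refine hker _ (brk_triple E.T_triple hd hs) ?_
      rw [LieHom.map_lie, h2, zero_lie]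
    · rintro ⟨d, hd, hdt, k, hk, rfl⟩
      have h1 : φ d = 0 := by
        refine ht'.zero_of_comm (hT2 d hd) fun s hs => ?_
        obtain ⟨s, hs1, rfl⟩ := hS s hs
        rw [← LieHom.map_lie]
        exact hker' _ (hdt s hs1)
      rw [map_add, h1, hker' k hk, add_zero]
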